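/- arXiv:1501.05637 — 2 statements merged into one kernel-verified Lean document; each statement's English description precedes it below -/
import Mathlib

section
/- Let I₄(x,y) = ∫_0^{x−y} K₂(2t,0) dt and for u,v ∈ ℝ define ℛ_{u,v}(x,y) = I₄(x+u, y+v) − 1/4 if y < x, and ℛ_{u,v}(x,y) = I₄(x+u, y+v) + 1/4 if y ≥ x. There exists a constant C > 0 such that for every α > 0, all u,v ∈ [−α,α], every y ∈ ℝ and every interval 𝒜 ⊂ ℝ: | ∫_𝒜 ℛ_{u,v}(x,y) dx | ≤ C · max(1,α). -/
/-- The sine kernel `K₂(x,y) = sin(π(x−y))/(π(x−y))` for `x ≠ y`, `K₂(x,x) = 1`. -/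
noncomputable def sineKernel (x y : ℝ) : ℝ :=
  if x = y then 1 else Real.sin (Real.pi * (x - y)) / (Real.pi * (x - y))

/-- `I₄(x,y) = ∫_0^{x−y} K₂(2t,0) dt`, the (2,1)-entry of the limiting matrix kernel
`K₄` for symplectic (β = 4) invariant ensembles. -/
noncomputable def I4 (x y : ℝ) : ℝ := ∫ t in (0 : ℝ)..(x - y), sineKernel (2 * t) 0

/-- `ℛ_{u,v}(x,y) = I₄(x+u,y+v) − ¼` if `y < x` and `= I₄(x+u,y+v) + ¼` if `y ≥ x`:
the integrable part of `I₄`, obtained by subtracting its singular jump `±¼`. -/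
noncomputable def Rker (u v x y : ℝ) : ℝ :=
  if y < x then I4 (x + u) (y + v) - 1 / 4 else I4 (x + u) (y + v) + 1 / 4

open MeasureTheory Set

theorem integral_exp_neg_mul_Ioi {x : ℝ} (hx : 0 < x) :
    ∫ t in Ioi (0 : ℝ), Real.exp (-x * t) = x⁻¹ := by
  rw [integral_exp_mul_Ioi (by linarith) 0]
  simp

theorem integral_sin_mul_exp_neg_mul (t R : ℝ) :
    ∫ x in (0 : ℝ)..R, Real.sin x * Real.exp (-x * t) =
      (1 + t ^ 2)⁻¹ - Real.exp (-R * t) * (Real.cos R + t * Real.sin R) / (1 + t ^ 2) := by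
  have ht : (1 + t ^ 2 : ℝ) ≠ 0 := by positivity
  have hd : ∀ x : ℝ, HasDerivAt
      (fun x => -(Real.exp (-x * t) * (Real.cos x + t * Real.sin x) / (1 + t ^ 2)))
      (Real.sin x * Real.exp (-x * t)) x := by
    intro x
    have h1 : HasDerivAt (fun x : ℝ => Real.exp (-x * t)) (Real.exp (-x * t) * (-1 * t)) x :=
      (((hasDerivAt_id x).neg).mul_const t).exp
    have h2 : HasDerivAt (fun x : ℝ => Real.cos x + t * Real.sin x)
        (-Real.sin x + t * Real.cos x) x :=
      (Real.hasDerivAt_cos x).add ((Real.hasDerivAt_sin x).const_mul t)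
    refine (((h1.mul h2).div_const (1 + t ^ 2)).neg).congr_deriv ?_
    field_simp
    ring
  rw [intervalIntegral.integral_eq_sub_of_hasDerivAt (fun x _ => hd x)
    (Continuous.intervalIntegrable (by fun_prop) _ _)]
  simp
  ring

theorem integrable_sin_mul_exp_neg_mul_prod (R : ℝ) :
    Integrable (fun p : ℝ × ℝ => Real.sin p.1 * Real.exp (-p.1 * p.2))
      ((volume.restrict (Ioc 0 R)).prod (volume.restrict (Ioi 0))) := by
  have hc : Continuous (fun p : ℝ × ℝ => Real.sin p.1 * Real.exp (-p.1 * p.2)) := by fun_prop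
  rw [integrable_prod_iff hc.aestronglyMeasurable]
  constructor
  · refine (ae_restrict_iff' measurableSet_Ioc).2 (.of_forall fun x hx => ?_)
    have h0 : -x < 0 := neg_lt_zero.2 hx.1
    exact (integrableOn_exp_mul_Ioi h0 0).const_mul (Real.sin x)
  · refine Measure.integrableOn_of_bounded (M := 1) (by simp)
      hc.norm.stronglyMeasurable.integral_prod_right.aestronglyMeasurable ?_
    refine (ae_restrict_iff' measurableSet_Ioc).2 (.of_forall fun x hx => ?_)
    have h0 : 0 < x := hx.1
    simp only [norm_mul, Real.norm_eq_abs, Real.abs_exp]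
    rw [integral_const_mul, integral_exp_neg_mul_Ioi h0, abs_of_nonneg (by positivity),
      ← div_eq_mul_inv, div_le_one h0]
    exact (Real.abs_sin_le_abs).trans (abs_of_pos h0).le

theorem abs_integral_sinc_sub_pi_div_two_le {R : ℝ} (hR : 0 < R) :
    |(∫ x in (0 : ℝ)..R, Real.sinc x) - Real.pi / 2| ≤ 2 / R := by
  set g : ℝ → ℝ := fun t =>
    Real.exp (-R * t) * (Real.cos R + t * Real.sin R) / (1 + t ^ 2) with hg
  have hbound : ∀ t ∈ Ioi (0 : ℝ), ‖g t‖ ≤ 2 * Real.exp (-R * t) := by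
    intro t ht
    have ht0 : 0 < t := ht
    have h1 : |Real.cos R + t * Real.sin R| ≤ 1 + t := by
      refine (abs_add_le _ _).trans (add_le_add (Real.abs_cos_le_one R) ?_)
      rw [abs_mul, abs_of_pos ht0]
      exact mul_le_of_le_one_right ht0.le (Real.abs_sin_le_one R)
    rw [hg, Real.norm_eq_abs, abs_div, abs_mul, Real.abs_exp,
      abs_of_pos (show 0 < 1 + t ^ 2 by positivity), div_le_iff₀ (by positivity)]
    calc Real.exp (-R * t) * |Real.cos R + t * Real.sin R|
        ≤ Real.exp (-R * t) * (2 * (1 + t ^ 2)) := by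
          gcongr
          nlinarith [sq_nonneg (t - 1)]
      _ = _ := by ring
  have hexp : IntegrableOn (fun t => 2 * Real.exp (-R * t)) (Ioi 0) :=
    (integrableOn_exp_mul_Ioi (by linarith) 0).const_mul 2
  have hgc : Continuous g :=
    Continuous.div (by fun_prop) (by fun_prop) fun t => by positivity
  have hgi : IntegrableOn g (Ioi 0) :=
    Integrable.mono' hexp hgc.aestronglyMeasurable
      ((ae_restrict_iff' measurableSet_Ioi).2 (.of_forall hbound))
  have key : ∫ x in (0 : ℝ)..R, Real.sinc x = Real.pi / 2 - ∫ t in Ioi (0 : ℝ), g t := by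
    calc ∫ x in (0 : ℝ)..R, Real.sinc x
        = ∫ x in Ioc 0 R, ∫ t in Ioi (0 : ℝ), Real.sin x * Real.exp (-x * t) := by
          rw [intervalIntegral.integral_of_le hR.le]
          refine setIntegral_congr_fun measurableSet_Ioc fun x hx => ?_
          rw [integral_const_mul, integral_exp_neg_mul_Ioi hx.1,
            Real.sinc_of_ne_zero hx.1.ne', div_eq_mul_inv]
      _ = ∫ t in Ioi (0 : ℝ), ∫ x in Ioc 0 R, Real.sin x * Real.exp (-x * t) :=
          integral_integral_swap (integrable_sin_mul_exp_neg_mul_prod R)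
      _ = ∫ t in Ioi (0 : ℝ), ((1 + t ^ 2)⁻¹ - g t) := by
          refine integral_congr_ae (.of_forall fun t => ?_)
          simp only
          rw [← intervalIntegral.integral_of_le hR.le, integral_sin_mul_exp_neg_mul]
      _ = _ := by
          rw [integral_sub integrable_inv_one_add_sq.integrableOn hgi,
            integral_Ioi_inv_one_add_sq]
          simp
  rw [key, sub_sub_cancel_left, abs_neg]
  calc |∫ t in Ioi (0 : ℝ), g t| ≤ ∫ t in Ioi (0 : ℝ), 2 * Real.exp (-R * t) :=
        norm_integral_le_of_norm_le hexp
          ((ae_restrict_iff' measurableSet_Ioi).2 (.of_forall hbound))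
    _ = 2 / R := by rw [integral_const_mul, integral_exp_neg_mul_Ioi hR, div_eq_mul_inv]

theorem sineKernel_two_mul_zero (t : ℝ) :
    sineKernel (2 * t) 0 = Real.sinc (2 * Real.pi * t) := by
  rcases eq_or_ne t 0 with rfl | ht
  · simp [sineKernel]
  · have h : Real.pi * (2 * t - 0) = 2 * Real.pi * t := by ring
    rw [sineKernel, if_neg (by simpa using ht), h,
      Real.sinc_of_ne_zero (by have := Real.pi_pos; positivity)]

/-- The function `s ↦ ∫_0^s K₂(2t,0) dt`, so that `I₄(x,y)` is its value at `x - y`. -/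
noncomputable def sineKernelPrimitive (s : ℝ) : ℝ :=
  ∫ t in (0 : ℝ)..s, Real.sinc (2 * Real.pi * t)

theorem I4_eq (x y : ℝ) : I4 x y = sineKernelPrimitive (x - y) := by
  simp only [I4, sineKernelPrimitive, sineKernel_two_mul_zero]

theorem hasDerivAt_sineKernelPrimitive (s : ℝ) :
    HasDerivAt sineKernelPrimitive (Real.sinc (2 * Real.pi * s)) s := by
  have hc : Continuous fun t => Real.sinc (2 * Real.pi * t) :=
    Real.continuous_sinc.comp (by fun_prop)
  exact intervalIntegral.integral_hasDerivAt_right (hc.intervalIntegrable _ _)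
    (hc.stronglyMeasurableAtFilter _ _) hc.continuousAt

theorem continuous_sineKernelPrimitive : Continuous sineKernelPrimitive :=
  continuous_iff_continuousAt.2 fun s => (hasDerivAt_sineKernelPrimitive s).continuousAt

theorem sineKernelPrimitive_eq (s : ℝ) :
    sineKernelPrimitive s = (2 * Real.pi)⁻¹ * ∫ x in (0 : ℝ)..(2 * Real.pi * s), Real.sinc x := by
  have := Real.pi_pos
  rw [sineKernelPrimitive, intervalIntegral.integral_comp_mul_left _ (by positivity)]
  simp

theorem sineKernelPrimitive_neg (s : ℝ) :
    sineKernelPrimitive (-s) = -sineKernelPrimitive s := by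
  have h := intervalIntegral.integral_comp_neg (a := 0) (b := s)
    (fun t => Real.sinc (2 * Real.pi * t))
  simp only [mul_neg, Real.sinc_neg, neg_zero] at h
  rw [sineKernelPrimitive, sineKernelPrimitive, h, intervalIntegral.integral_symm]

theorem abs_mul_sineKernelPrimitive_sub_le (z : ℝ) :
    |z * sineKernelPrimitive z - |z| / 4| ≤ 1 := by
  wlog hz : 0 ≤ z generalizing z
  · simpa [sineKernelPrimitive_neg] using this (-z) (by linarith)
  rcases hz.eq_or_lt with rfl | hz
  · simp
  have hpi := Real.pi_gt_three
  have h := abs_integral_sinc_sub_pi_div_two_le (R := 2 * Real.pi * z) (by positivity)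
  have e : z * sineKernelPrimitive z - |z| / 4 = z / (2 * Real.pi) *
      ((∫ x in (0 : ℝ)..(2 * Real.pi * z), Real.sinc x) - Real.pi / 2) := by
    rw [sineKernelPrimitive_eq, abs_of_pos hz]
    field_simp
    ring
  rw [e, abs_mul, abs_of_pos (show 0 < z / (2 * Real.pi) by positivity)]
  calc z / (2 * Real.pi) * |(∫ x in (0 : ℝ)..(2 * Real.pi * z), Real.sinc x) - Real.pi / 2|
      ≤ z / (2 * Real.pi) * (2 / (2 * Real.pi * z)) := by gcongr
    _ = 1 / (2 * Real.pi ^ 2) := by field_simp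
    _ ≤ 1 := by rw [div_le_one (by positivity)]; nlinarith

/-- An explicit primitive of `sineKernelPrimitive`, obtained by integration by parts. -/
noncomputable def sineKernelPrimitive₂ (z : ℝ) : ℝ :=
  z * sineKernelPrimitive z + Real.cos (2 * Real.pi * z) / (2 * Real.pi) ^ 2

theorem hasDerivAt_sineKernelPrimitive₂ (z : ℝ) :
    HasDerivAt sineKernelPrimitive₂ (sineKernelPrimitive z) z := by
  have hpi := Real.pi_pos
  have h1 := (hasDerivAt_id z).mul (hasDerivAt_sineKernelPrimitive z)
  have h2 := (((hasDerivAt_id z).const_mul (2 * Real.pi)).cos).div_const ((2 * Real.pi) ^ 2)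
  refine (h1.add h2).congr_deriv ?_
  rcases eq_or_ne z 0 with rfl | hz
  · simp
  · simp only [id]
    rw [Real.sinc_of_ne_zero (by positivity)]
    field_simp
    ring

theorem abs_sineKernelPrimitive₂_sub_le (z : ℝ) :
    |sineKernelPrimitive₂ z - |z| / 4| ≤ 2 := by
  have hpi := Real.pi_gt_three
  have h1 := abs_mul_sineKernelPrimitive_sub_le z
  have h2 : |Real.cos (2 * Real.pi * z) / (2 * Real.pi) ^ 2| ≤ 1 := by
    rw [abs_div, abs_of_pos (show 0 < (2 * Real.pi) ^ 2 by positivity),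
      div_le_one (by positivity)]
    nlinarith [Real.abs_cos_le_one (2 * Real.pi * z)]
  rw [abs_le] at *
  rw [sineKernelPrimitive₂]
  constructor <;> linarith [h1.1, h1.2, h2.1, h2.2]

theorem Rker_eq (u v x y : ℝ) :
    Rker u v x y = sineKernelPrimitive (x - y + (u - v)) - if y < x then 1 / 4 else -(1 / 4) := by
  have h : x + u - (y + v) = x - y + (u - v) := by ring
  rw [Rker, I4_eq, h]
  split_ifs <;> ring

theorem intervalIntegrable_Rker (u v y a b : ℝ) :
    IntervalIntegrable (fun x => Rker u v x y) volume a b := by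
  simp only [Rker_eq]
  refine IntervalIntegrable.sub (Continuous.intervalIntegrable
    (continuous_sineKernelPrimitive.comp (by fun_prop)) _ _) (Monotone.intervalIntegrable ?_)
  intro x₁ x₂ h
  simp only
  split_ifs <;> linarith

theorem integral_Rker (u v y a b : ℝ) :
    ∫ x in a..b, Rker u v x y =
      (sineKernelPrimitive₂ (b - y + (u - v)) - |b - y| / 4) -
        (sineKernelPrimitive₂ (a - y + (u - v)) - |a - y| / 4) := by
  have hd : ∀ x, HasDerivAt (fun x => sineKernelPrimitive₂ (x - y + (u - v)))
      (sineKernelPrimitive (x - y + (u - v))) x := fun x => by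
    have h : HasDerivAt (fun x : ℝ => x - y + (u - v)) 1 x :=
      ((hasDerivAt_id x).sub_const y).add_const (u - v)
    exact ((hasDerivAt_sineKernelPrimitive₂ _).comp x h).congr_deriv (mul_one _)
  have hc : Continuous fun x => sineKernelPrimitive₂ (x - y + (u - v)) :=
    continuous_iff_continuousAt.2 fun x => (hd x).continuousAt
  refine integral_eq_of_hasDerivAt_off_countable
    (fun x => sineKernelPrimitive₂ (x - y + (u - v)) - |x - y| / 4) _ (countable_singleton y)
    (by fun_prop) (fun x hx => ?_) (intervalIntegrable_Rker u v y a b)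
  rw [Rker_eq]
  refine (hd x).sub ?_
  have hsub := (hasDerivAt_id x).sub_const y
  rcases lt_or_gt_of_ne (show x ≠ y from hx.2) with h | h
  · rw [if_neg h.not_gt]
    refine (((hasDerivAt_abs_neg (sub_neg.2 h)).comp x hsub).div_const 4).congr_deriv ?_
    norm_num
  · rw [if_pos h]
    refine (((hasDerivAt_abs_pos (sub_pos.2 h)).comp x hsub).div_const 4).congr_deriv ?_
    norm_num

/-- There is `C > 0` such that for every `α > 0`, all `u,v ∈ [−α,α]`,
every `y ∈ ℝ` and every interval `[a,b]`: `|∫_a^b ℛ_{u,v}(x,y) dx| ≤ C·max(1,α)`. -/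
theorem Rker_interval_integral_le :
    ∃ C > 0, ∀ α : ℝ, 0 < α → ∀ u v : ℝ, |u| ≤ α → |v| ≤ α → ∀ y a b : ℝ,
      |∫ x in a..b, Rker u v x y| ≤ C * max 1 α := by
  refine ⟨5, by norm_num, fun α hα u v hu hv y a b => ?_⟩
  have hw : |u - v| ≤ 2 * α := (abs_sub u v).trans (by linarith)
  have bound : ∀ s : ℝ, |sineKernelPrimitive₂ (s + (u - v)) - |s| / 4| ≤ 2 + α / 2 := fun s => by
    have h1 := abs_le.1 (abs_sineKernelPrimitive₂_sub_le (s + (u - v)))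
    have h2 := abs_le.1 ((abs_abs_sub_abs_le_abs_sub (s + (u - v)) s).trans
      (by simpa using hw))
    exact abs_le.2 ⟨by linarith [h1.1, h2.1], by linarith [h1.2, h2.2]⟩
  rw [integral_Rker]
  have ha := abs_le.1 (bound (a - y))
  have hb := abs_le.1 (bound (b - y))
  have := le_max_left 1 α
  have := le_max_right 1 α
  exact abs_le.2 ⟨by linarith [ha.2, hb.1], by linarith [ha.1, hb.2]⟩
end

section
/- Let r > 2 be an integer. Define the 2×2 matrix kernel K₄(x,y) with entries (K₄)₁₁(x,y) = (K₄)₂₂(y,x) = S₄(x,y), (K₄)₁₂(x,y) = D₄(x,y), (K₄)₂₁(x,y) = I₄(x,y), where S₄(x,y) = K₂(2x,2y), D₄(x,y) = ∂ₓK₂(2x,2y), I₄(x,y) = ∫_0^{x−y} K₂(2t,0) dt. For t = (t₁,…,t_r) ∈ ℝ^r and d = (d₁,…,d_{r−2}) ∈ {1,2}^{r−2} set G(t,d) = (K₄(t₁,t₂))_{1,d₁} (K₄(t₂,t₃))_{d₁,d₂} ⋯ (K₄(t_{r−1},t_r))_{d_{r−2},2}. Let A ⊂ ℝ be a bounded interval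 and let f : ℝ^r → ℝ be a bounded measurable function that is invariant under every permutation of its r arguments. Then Σ_{d₁,…,d_{r−2} = 1}^{2} ∫_{A^r} G(t,d) f(t) dt₁ ⋯ dt_r = 0. -/
open MeasureTheory

/-- `S₄(x,y) = K₂(2x,2y)`. -/
noncomputable def S4 (x y : ℝ) : ℝ := sineKernel (2 * x) (2 * y)

/-- `D₄(x,y) = ∂ₓK₂(2x,2y)`. -/
noncomputable def D4 (x y : ℝ) : ℝ :=
  if x = y then 0
  else (2 * Real.pi * (x - y) * Real.cos (2 * Real.pi * (x - y))
          - Real.sin (2 * Real.pi * (x - y)))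
        / (2 * Real.pi * (x - y) ^ 2)

/-- The limiting 2×2 matrix kernel `K₄` for symplectic (β = 4) invariant ensembles:
`(K₄)₁₁(x,y) = (K₄)₂₂(y,x) = S₄(x,y)`, `(K₄)₁₂(x,y) = D₄(x,y)`,
`(K₄)₂₁(x,y) = I₄(x,y)`. (Row/column index `0 : Fin 2` encodes the kernel index `1`,
and `1 : Fin 2` encodes the kernel index `2`.) -/
noncomputable def K4mat (x y : ℝ) : Matrix (Fin 2) (Fin 2) ℝ :=
  !![S4 x y, D4 x y; I4 x y, S4 y x]

/-- The sequence of matrix indices `1, d₁, d₂, …, d_{r−2}, 2` (encoded in `Fin 2`,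
with `0 ↔ 1` and `1 ↔ 2`) appearing in the product `G`. -/
def eIdx (r : ℕ) (d : Fin (r - 2) → Fin 2) (i : Fin r) : Fin 2 :=
  if i.val = 0 then 0
  else if i.val = r - 1 then 1
  else if h : i.val - 1 < r - 2 then d ⟨i.val - 1, h⟩ else 0

/-- `G(t,d) = (K₄(t₁,t₂))_{1,d₁} (K₄(t₂,t₃))_{d₁,d₂} ⋯ (K₄(t_{r−1},t_r))_{d_{r−2},2}`. -/
noncomputable def Gprod (r : ℕ) (d : Fin (r - 2) → Fin 2) (t : Fin r → ℝ) : ℝ :=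
  ∏ j : Fin (r - 1),
    K4mat (t ⟨j.val, by omega⟩) (t ⟨j.val + 1, by omega⟩)
      (eIdx r d ⟨j.val, by omega⟩) (eIdx r d ⟨j.val + 1, by omega⟩)

theorem sineKernel_comm (x y : ℝ) : sineKernel y x = sineKernel x y := by
  unfold sineKernel
  by_cases h : x = y
  · simp [h]
  · rw [if_neg h, if_neg (Ne.symm h), ← neg_sub x y, mul_neg, Real.sin_neg, neg_div_neg_eq]

theorem sineKernel_neg_neg (x y : ℝ) : sineKernel (-x) (-y) = sineKernel x y := by
  rw [← sineKernel_comm x y]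
  unfold sineKernel
  rw [show -x - -y = y - x by ring]
  simp only [neg_inj, eq_comm]

theorem S4_comm (x y : ℝ) : S4 y x = S4 x y := sineKernel_comm _ _

theorem D4_swap (x y : ℝ) : D4 y x = -D4 x y := by
  unfold D4
  by_cases h : x = y
  · simp [h]
  · rw [if_neg h, if_neg (Ne.symm h), ← neg_sub x y, mul_neg, Real.sin_neg, Real.cos_neg, neg_sq,
      ← neg_div]
    ring

theorem I4_swap (x y : ℝ) : I4 y x = -I4 x y := by
  have h := intervalIntegral.integral_comp_neg (a := 0) (b := x - y)
    (fun t : ℝ => sineKernel (2 * t) 0)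
  have heven (t : ℝ) : sineKernel (2 * -t) 0 = sineKernel (2 * t) 0 := by
    rw [← sineKernel_neg_neg (2 * t), neg_zero, mul_neg]
  simp only [heven, neg_zero, neg_sub] at h
  rw [I4, I4, h, intervalIntegral.integral_symm]

/-- The sign attached to a row or column index of the kernel: `1` for `0` and `-1` for `1`. -/
def indexSign (i : Fin 2) : ℝ := if i = 0 then 1 else -1

theorem K4mat_swap (x y : ℝ) (i j : Fin 2) :
    K4mat y x i j = indexSign j / indexSign i * K4mat x y j.rev i.rev := by
  fin_cases i <;> fin_cases j <;>
    simp [K4mat, indexSign, S4_comm x y, D4_swap x y, I4_swap x y]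

/-- The reversal-flip `d*` of an index vector `d`. -/
def revFlip (n : ℕ) : (Fin n → Fin 2) ≃ (Fin n → Fin 2) :=
  Function.Involutive.toPerm (fun d k => (d k.rev).rev) fun d => by
    funext k
    simp

theorem eIdx_revFlip {r : ℕ} (hr : 2 < r) (d : Fin (r - 2) → Fin 2) (i : Fin r) :
    eIdx r (revFlip (r - 2) d) i = (eIdx r d i.rev).rev := by
  have hi := i.isLt
  have hv : i.rev.val = r - (i.val + 1) := Fin.val_rev i
  unfold eIdx
  by_cases h0 : i.val = 0
  · rw [if_pos h0, if_neg (by omega), if_pos (by omega)]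
    rfl
  by_cases h1 : i.val = r - 1
  · rw [if_neg h0, if_pos h1, if_pos (by omega)]
    rfl
  rw [if_neg h0, if_neg h1, dif_pos (by omega), if_neg (by omega), if_neg (by omega),
    dif_pos (by omega)]
  change (d _).rev = _
  congr 2
  ext
  simp only [Fin.val_rev]
  omega

theorem prod_indexSign_eIdx {r : ℕ} (hr : 2 < r) (d : Fin (r - 2) → Fin 2) :
    ∏ j : Fin (r - 1), indexSign (eIdx r d ⟨j.val + 1, by omega⟩) /
      indexSign (eIdx r d ⟨j.val, by omega⟩) = -1 := by
  let g : ℕ → ℝ := fun k => if h : k < r then indexSign (eIdx r d ⟨k, h⟩) else 1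
  have hg (k : ℕ) (h : k < r) : g k = indexSign (eIdx r d ⟨k, h⟩) := dif_pos h
  have hg0 (k : ℕ) : g k ≠ 0 := by
    simp only [g, indexSign]
    split_ifs <;> norm_num
  have htel (n : ℕ) : ∏ k ∈ Finset.range n, g (k + 1) / g k = g n / g 0 := by
    induction n with
    | zero => simp [hg0]
    | succ n ih =>
      rw [Finset.prod_range_succ, ih]
      field_simp [hg0]
  calc _ = ∏ j : Fin (r - 1), g (j.val + 1) / g j.val := by
        refine Finset.prod_congr rfl fun j _ => ?_
        rw [hg _ (by omega), hg _ (by omega)]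
    _ = g (r - 1) / g 0 := by
        rw [Fin.prod_univ_eq_prod_range (fun k => g (k + 1) / g k), htel]
    _ = -1 := by
        rw [hg _ (by omega), hg _ (by omega)]
        simp [eIdx, indexSign, show r - 1 ≠ 0 by omega]

theorem Gprod_comp_rev {r : ℕ} (hr : 2 < r) (d : Fin (r - 2) → Fin 2) (t : Fin r → ℝ) :
    Gprod r d (t ∘ Fin.rev) = -Gprod r (revFlip (r - 2) d) t := by
  have hrev : Gprod r (revFlip (r - 2) d) t = ∏ j : Fin (r - 1),
      K4mat (t (Fin.rev ⟨j.val + 1, by omega⟩)) (t (Fin.rev ⟨j.val, by omega⟩))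
        (eIdx r d ⟨j.val + 1, by omega⟩).rev (eIdx r d ⟨j.val, by omega⟩).rev := by
    unfold Gprod
    rw [← Equiv.prod_comp Fin.revPerm]
    refine Finset.prod_congr rfl fun j _ => ?_
    have hj : (⟨(Fin.revPerm j).val, by omega⟩ : Fin r) = Fin.rev ⟨j.val + 1, by omega⟩ := by
      ext
      simp only [Fin.revPerm_apply, Fin.val_rev]
      omega
    have hj' : (⟨(Fin.revPerm j).val + 1, by omega⟩ : Fin r) = Fin.rev ⟨j.val, by omega⟩ := by
      ext
      simp only [Fin.revPerm_apply, Fin.val_rev]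
      omega
    rw [hj, hj', eIdx_revFlip hr, eIdx_revFlip hr, Fin.rev_rev, Fin.rev_rev]
  rw [hrev, ← neg_one_mul, ← prod_indexSign_eIdx hr d, ← Finset.prod_mul_distrib]
  exact Finset.prod_congr rfl fun j _ => K4mat_swap _ _ _ _

theorem setIntegral_pi_Icc_comp_perm {r : ℕ} (a b : ℝ) (σ : Equiv.Perm (Fin r))
    (g : (Fin r → ℝ) → ℝ) :
    ∫ t in (Set.univ.pi fun _ : Fin r => Set.Icc a b), g (t ∘ σ) =
      ∫ t in (Set.univ.pi fun _ : Fin r => Set.Icc a b), g t := by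
  let e := MeasurableEquiv.piCongrLeft (fun _ : Fin r => ℝ) σ.symm
  have he : MeasurePreserving e volume volume :=
    volume_measurePreserving_piCongrLeft (fun _ : Fin r => ℝ) σ.symm
  have hcomp (t : Fin r → ℝ) : e t = t ∘ σ := by
    funext i
    simpa using MeasurableEquiv.piCongrLeft_apply_apply σ.symm (β := fun _ => ℝ) t (σ i)
  have hpre : e ⁻¹' (Set.univ.pi fun _ : Fin r => Set.Icc a b) =
      Set.univ.pi fun _ : Fin r => Set.Icc a b := by
    ext t
    simp only [Set.mem_preimage, hcomp, Set.mem_univ_pi, Function.comp_apply]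
    exact σ.forall_congr_left.trans (by simp)
  have h := he.setIntegral_preimage_emb e.measurableEmbedding g
    (Set.univ.pi fun _ : Fin r => Set.Icc a b)
  simpa only [hpre, hcomp] using h

/-- For `r > 2`, a bounded interval `A = [a,b]` and any bounded measurable
function `f : ℝ^r → ℝ` invariant under all permutations of its arguments,
`Σ_{d ∈ {1,2}^{r−2}} ∫_{A^r} G(t,d) f(t) dt = 0`. -/
theorem sum_integral_Gprod_symm_eq_zero
    (r : ℕ) (hr : 2 < r) (a b : ℝ)
    (f : (Fin r → ℝ) → ℝ) (hmeas : Measurable f)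
    (hbd : ∃ M, ∀ t, |f t| ≤ M)
    (hsymm : ∀ (σ : Equiv.Perm (Fin r)) (t : Fin r → ℝ), f (t ∘ σ) = f t) :
    ∑ d : Fin (r - 2) → Fin 2,
      ∫ t in (Set.univ.pi fun _ : Fin r => Set.Icc a b), Gprod r d t * f t = 0 := by
  have hflip (d : Fin (r - 2) → Fin 2) :
      ∫ t in (Set.univ.pi fun _ : Fin r => Set.Icc a b), Gprod r d t * f t =
        -∫ t in (Set.univ.pi fun _ : Fin r => Set.Icc a b),
          Gprod r (revFlip (r - 2) d) t * f t := by
    rw [← setIntegral_pi_Icc_comp_perm a b Fin.revPerm, ← integral_neg]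
    congr 1
    funext t
    rw [hsymm, ← neg_mul, ← Gprod_comp_rev hr]
    rfl
  refine self_eq_neg.mp ?_
  rw [← Finset.sum_neg_distrib, ← Equiv.sum_comp (revFlip (r - 2)) (fun d =>
    -∫ t in (Set.univ.pi fun _ : Fin r => Set.Icc a b), Gprod r d t * f t)]
  exact Finset.sum_congr rfl fun d _ => hflip d
end
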